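/- Let G and H be finite connected simple graphs. Suppose there exist vertices u1, v1, w1 of G with u1 ≠ w1, u1 adjacent to v1 in E(G), v1 adjacent to w1 in E(G), and e(v1) ≥ max(e(u1), e(w1)); and there exist vertices u2, v2, w2 of H with u2 ≠ w2, u2 adjacent to v2 in E(H), v2 adjacent to w2 in E(H), and e(v2) ≤ min(e(u2), e(w2)). Then the eccentric graph E(G □ H) contains a 4-cycle, namely (u1,v2), (v1,w2), (w1,v2), (v1,u2) are four distinct vertices forming a cycle of length 4 in E(G □ H). -/

import Mathlib

open SimpleGraph

/-- The eccentricity of a vertex `v`: the max distance from `v` to any vertex. -/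
noncomputable def ecc {V : Type*} [Fintype V] (G : SimpleGraph V) (v : V) : ℕ :=
  Finset.univ.sup fun u => G.dist v u

/-- `u` is eccentric to `v` in `G` if `d(v,u) = e(v)`. -/
def IsEccentric {V : Type*} [Fintype V] (G : SimpleGraph V) (v u : V) : Prop :=
  G.dist v u = ecc G v

/-- The eccentric graph of `G`: distinct `u, v` adjacent iff one is eccentric to the other. -/
noncomputable def eccGraph {V : Type*} [Fintype V] (G : SimpleGraph V) : SimpleGraph V :=
  SimpleGraph.fromRel fun u v => IsEccentric G u v

/-- The diameter of `G`: the maximum eccentricity. -/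
noncomputable def gdiam {V : Type*} [Fintype V] (G : SimpleGraph V) : ℕ :=
  Finset.univ.sup fun v => ecc G v
/-- A distance from `v` is at most the eccentricity of `v`. -/
lemma dist_le_ecc {V : Type*} [Fintype V] (G : SimpleGraph V) (v u : V) :
    G.dist v u ≤ ecc G v :=
  Finset.le_sup (f := fun u => G.dist v u) (Finset.mem_univ u)

/-- The eccentricity of a vertex is attained. -/
lemma exists_dist_eq_ecc {V : Type*} [Fintype V] (G : SimpleGraph V) (v : V) :
    ∃ u, G.dist v u = ecc G v := by
  obtain ⟨u, -, hu⟩ := Finset.exists_mem_eq_sup Finset.univ ⟨v, Finset.mem_univ v⟩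
    fun u => G.dist v u
  exact ⟨u, hu.symm⟩

/-- Of two adjacent vertices of the eccentric graph, the one of larger eccentricity is eccentric
to the other. -/
lemma isEccentric_of_adj_eccGraph {V : Type*} [Fintype V] {G : SimpleGraph V} {u v : V}
    (h : (eccGraph G).Adj u v) (he : ecc G u ≤ ecc G v) : IsEccentric G u v := by
  obtain ⟨-, h | h⟩ := (SimpleGraph.fromRel_adj _ _ _).1 h
  · exact h
  · refine (dist_le_ecc G u v).antisymm (he.trans ?_)
    rw [SimpleGraph.dist_comm]
    exact h.ge

/-- Distances in a box product of connected graphs are sums of distances in the factors. -/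
lemma dist_boxProd {α β : Type*} {G : SimpleGraph α} {H : SimpleGraph β} (hG : G.Connected)
    (hH : H.Connected) (x y : α × β) :
    (G.boxProd H).dist x y = G.dist x.1 y.1 + H.dist x.2 y.2 := by
  rw [SimpleGraph.dist, SimpleGraph.edist_boxProd]
  exact ENat.toNat_add (SimpleGraph.edist_ne_top_iff_reachable.2 (hG.preconnected _ _))
    (SimpleGraph.edist_ne_top_iff_reachable.2 (hH.preconnected _ _))

/-- Eccentricities in a box product of connected graphs are sums of eccentricities in the
factors. -/
lemma ecc_boxProd {α β : Type*} [Fintype α] [Fintype β] {G : SimpleGraph α} {H : SimpleGraph β}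
    (hG : G.Connected) (hH : H.Connected) (x : α × β) :
    ecc (G.boxProd H) x = ecc G x.1 + ecc H x.2 := by
  refine le_antisymm (Finset.sup_le fun y _ => ?_) ?_
  · rw [dist_boxProd hG hH]
    exact add_le_add (dist_le_ecc ..) (dist_le_ecc ..)
  · obtain ⟨a, ha⟩ := exists_dist_eq_ecc G x.1
    obtain ⟨b, hb⟩ := exists_dist_eq_ecc H x.2
    rw [← ha, ← hb, ← dist_boxProd hG hH x (a, b)]
    exact dist_le_ecc ..

/-- A pair of eccentric vertices in the factors gives adjacent vertices in the eccentric graph of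
the box product. -/
lemma eccGraph_boxProd_adj {α β : Type*} [Fintype α] [Fintype β] {G : SimpleGraph α}
    {H : SimpleGraph β} (hG : G.Connected) (hH : H.Connected) {u v : α} {x y : β} (huv : u ≠ v)
    (h : IsEccentric G u v) (h' : IsEccentric H x y) :
    (eccGraph (G.boxProd H)).Adj (u, x) (v, y) := by
  refine (SimpleGraph.fromRel_adj _ _ _).2 ⟨fun e => huv (congrArg Prod.fst e), Or.inl ?_⟩
  rw [IsEccentric, dist_boxProd hG hH, ecc_boxProd hG hH]
  exact congrArg₂ (· + ·) h h'

/-- A 4-cycle in the eccentric graph of a box product, built from suitable paths of length 2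
in the eccentric graphs of the factors. -/
theorem stmt_6 {α β : Type*} [Fintype α] [Fintype β]
    (G : SimpleGraph α) (H : SimpleGraph β) (hG : G.Connected) (hH : H.Connected)
    (u1 v1 w1 : α) (u2 v2 w2 : β)
    (h1 : u1 ≠ w1) (h1a : (eccGraph G).Adj u1 v1) (h1b : (eccGraph G).Adj v1 w1)
    (h1e : max (ecc G u1) (ecc G w1) ≤ ecc G v1)
    (h2 : u2 ≠ w2) (h2a : (eccGraph H).Adj u2 v2) (h2b : (eccGraph H).Adj v2 w2)
    (h2e : ecc H v2 ≤ min (ecc H u2) (ecc H w2)) :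
    (let a : α × β := (u1, v2); let b : α × β := (v1, w2);
     let c : α × β := (w1, v2); let d : α × β := (v1, u2);
     a ≠ b ∧ a ≠ c ∧ a ≠ d ∧ b ≠ c ∧ b ≠ d ∧ c ≠ d ∧
       (eccGraph (G.boxProd H)).Adj a b ∧ (eccGraph (G.boxProd H)).Adj b c ∧
       (eccGraph (G.boxProd H)).Adj c d ∧ (eccGraph (G.boxProd H)).Adj d a) := by
  obtain ⟨hu1, hw1⟩ := max_le_iff.1 h1e
  obtain ⟨hu2, hw2⟩ := le_min_iff.1 h2e
  have eu1 := isEccentric_of_adj_eccGraph h1a hu1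
  have ew1 := isEccentric_of_adj_eccGraph h1b.symm hw1
  have eu2 := isEccentric_of_adj_eccGraph h2a.symm hu2
  have ew2 := isEccentric_of_adj_eccGraph h2b hw2
  have ab := eccGraph_boxProd_adj hG hH h1a.ne eu1 ew2
  have cb := eccGraph_boxProd_adj hG hH h1b.ne' ew1 ew2
  have cd := eccGraph_boxProd_adj hG hH h1b.ne' ew1 eu2
  have ad := eccGraph_boxProd_adj hG hH h1a.ne eu1 eu2
  exact ⟨ab.ne, fun e => h1 (congrArg Prod.fst e), ad.ne, cb.ne',
    fun e => h2 (congrArg Prod.snd e).symm, cd.ne, ab, cb.symm, cd, ad.symm⟩
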